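/- arXiv:1210.1635 — 2 statements merged into one kernel-verified Lean document; each statement's English description precedes it below -/
import Mathlib

section
/- Let W be an infinite, irreducible, non-affine right-angled Coxeter group with finite generating set S. Then r(W) ≤ 1; that is, there exist finitely many elements g_1, …, g_m ∈ W such that W = g_1·A_1(W) ∪ ⋯ ∪ g_m·A_1(W). -/
open scoped Pointwise

/-- `algA G i` is the set of elements of `G` whose centralizer contains a
free abelian subgroup of rank at most `i` as a subgroup of finite index. -/
def algA (G : Type*) [Group G] (i : ℕ) : Set G :=
  {g : G | ∃ H : Subgroup (Subgroup.centralizer ({g} : Set G)),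
    H.FiniteIndex ∧ ∃ n : ℕ, n ≤ i ∧ Nonempty (H ≃* Multiplicative (Fin n → ℤ))}

/-- `G` is covered by finitely many left translates of `algA G i`. -/
def algCovers (G : Type*) [Group G] (i : ℕ) : Prop :=
  ∃ F : Finset G, (⋃ g ∈ F, g • algA G i) = Set.univ

/-- `r(G)`: the least `i` such that `G` is a finite union of translates of `algA G i`
(`⊤` if there is no such `i`). -/
noncomputable def algr (G : Type*) [Group G] : ℕ∞ :=
  sInf {n : ℕ∞ | ∃ i : ℕ, n = (i : ℕ∞) ∧ algCovers G i}

/-- The algebraic rank of `G`: the supremum of `r(G*)` over all finite index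
subgroups `G*` of `G`. -/
noncomputable def algRank (G : Type*) [Group G] : ℕ∞ :=
  ⨆ (H : Subgroup G) (_ : H.FiniteIndex), algr H

/-- A Coxeter matrix is right-angled if all off-diagonal entries are `2` or `∞`
(`0` encodes `∞` in Mathlib's convention, i.e. the order of `st` is `2` or `∞`). -/
def CoxeterMatrix.IsRightAngled {B : Type*} (M : CoxeterMatrix B) : Prop :=
  ∀ i j : B, i ≠ j → M i j = 2 ∨ M i j = 0

namespace CoxeterSystem

variable {B : Type*} {W : Type*} [Group W] {M : CoxeterMatrix B} (cs : CoxeterSystem M W)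

/-- The Coxeter system is irreducible: the generating set cannot be partitioned into two
nonempty subsets such that every generator in one commutes with every generator in the
other. -/
def IsIrreducible : Prop :=
  ¬ ∃ A : Set B, A.Nonempty ∧ Aᶜ.Nonempty ∧
      ∀ i ∈ A, ∀ j ∈ Aᶜ, Commute (cs.simple i) (cs.simple j)

/-- A word over `S` is reduced if no shorter word represents the same element of `W`. -/
def ReducedWord (l : List B) : Prop :=
  ∀ l' : List B, cs.wordProd l' = cs.wordProd l → l.length ≤ l'.length

/-- An element `w ∈ W` is essential if the only parabolic subgroup containing it is `W`
itself: whenever `w ∈ u W_J u⁻¹` (equivalently `u⁻¹ w u ∈ W_J`), one has `J = S`. -/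
def IsEssential (w : W) : Prop :=
  ∀ (u : W) (J : Set B),
    u⁻¹ * w * u ∈ Subgroup.closure (cs.simple '' J) → J = Set.univ

/-- `t` is an `s`-blocker if the generators `s` and `t` do not commute. -/
def IsBlocker (s t : B) : Prop := ¬ Commute (cs.simple s) (cs.simple t)

/-- A word is `s`-minimal if between any two consecutive occurrences of `s`
there is an `s`-blocker (vacuously so if `s` occurs at most once). -/
def SMinimal (l : List B) (s : B) : Prop :=
  ∀ l₁ l₂ l₃ : List B, l = l₁ ++ s :: l₂ ++ s :: l₃ → s ∉ l₂ →
    ∃ t ∈ l₂, cs.IsBlocker s t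

/-- A word `l` is `s`-good if it is `s`-minimal and, whenever `s` occurs at least twice
(with `l₁` the prefix before the first occurrence of `s` and `l₃` the suffix after the
last occurrence), the word `l₃ ++ l₁` contains an `s`-blocker. -/
def SGood (l : List B) (s : B) : Prop :=
  cs.SMinimal l s ∧
    ∀ l₁ l₂ l₃ : List B, l = l₁ ++ s :: l₂ ++ s :: l₃ → s ∉ l₁ → s ∉ l₃ →
      ∃ t ∈ l₃ ++ l₁, cs.IsBlocker s t

/-- `B(w)`: the set of "bad" generators of a word, i.e. those for which the word is
not good. -/
def badSet (l : List B) : Set B := {s : B | ¬ cs.SGood l s}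

end CoxeterSystem

/-- A group is affine (in the sense relevant here) if it contains a free abelian
subgroup of finite index. -/
def IsVirtuallyFreeAbelian (W : Type*) [Group W] : Prop :=
  ∃ H : Subgroup W, H.FiniteIndex ∧ ∃ ι : Type, Nonempty (H ≃* Multiplicative (ι →₀ ℤ))

namespace RightAngled

section Pilings

variable {B : Type*} (M : CoxeterMatrix B)

/-- The bead of type `s` is on top of its stack in the piling `σ`. -/
def IsTop (s : B) (σ : B → List Bool) : Prop := (σ s).head? = some true

open Classical in
/-- Put a bead of type `s` on top of a piling, and a blank tile on every stack whose type does
not commute with `s`. -/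
noncomputable def push (s : B) (σ : B → List Bool) : B → List Bool := fun t =>
  if t = s then true :: σ t else if M s t = 0 then false :: σ t else σ t

open Classical in
/-- Remove the top bead of type `s`, together with the matching blank tiles. -/
noncomputable def pop (s : B) (σ : B → List Bool) : B → List Bool := fun t =>
  if t = s ∨ M s t = 0 then (σ t).tail else σ t

open Classical in
/-- The action of the generator `s` on pilings. -/
noncomputable def act (s : B) (σ : B → List Bool) : B → List Bool :=
  if IsTop s σ then pop M s σ else push M s σ

/-- The pilings obtained from the empty one by pushing beads, never twice in a row the same. -/
inductive Valid : (B → List Bool) → Prop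
  | empty : Valid fun _ => []
  | cons (s : B) (σ : B → List Bool) : Valid σ → ¬ IsTop s σ → Valid (push M s σ)

variable {M}

theorem pop_push (s : B) (σ : B → List Bool) : pop M s (push M s σ) = σ := by
  funext t
  by_cases h : t = s <;> by_cases h' : M s t = 0 <;> simp [pop, push, h, h']

theorem isTop_push_self (s : B) (σ : B → List Bool) : IsTop s (push M s σ) := by
  simp [IsTop, push]

theorem not_isTop_push {s t : B} (h : M s t = 0) (σ : B → List Bool) :
    ¬ IsTop t (push M s σ) := by
  have hne : t ≠ s := by
    rintro rfl
    simp at h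
  simp [IsTop, push, hne, h]

theorem isTop_push_iff {s t : B} (hne : t ≠ s) (h : M s t ≠ 0) (σ : B → List Bool) :
    IsTop t (push M s σ) ↔ IsTop t σ := by
  simp [IsTop, push, hne, h]

theorem push_comm {s t : B} (hne : t ≠ s) (h : M s t ≠ 0) (σ : B → List Bool) :
    push M s (push M t σ) = push M t (push M s σ) := by
  have h' : M t s ≠ 0 := by rwa [M.symmetric]
  funext x
  by_cases h1 : x = s
  · subst h1
    simp [push, hne.symm, h']
  · by_cases h2 : x = t
    · subst h2
      simp [push, hne, h]
    · by_cases h3 : M s x = 0 <;> by_cases h4 : M t x = 0 <;> simp [push, h1, h2, h3, h4]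

theorem act_push {s : B} {σ : B → List Bool} : act M s (push M s σ) = σ := by
  rw [act, if_pos (isTop_push_self s σ), pop_push]

theorem act_of_not_isTop {s : B} {σ : B → List Bool} (h : ¬ IsTop s σ) :
    act M s σ = push M s σ := if_neg h

theorem Valid.exists_eq_push {σ : B → List Bool} (hσ : Valid M σ) {s : B} (hs : IsTop s σ) :
    ∃ τ, Valid M τ ∧ ¬ IsTop s τ ∧ σ = push M s τ := by
  induction hσ with
  | empty => simp [IsTop] at hs
  | cons r τ hτ hr ih =>
    by_cases hrs : s = r
    · subst hrs
      exact ⟨τ, hτ, hr, rfl⟩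
    by_cases hM : M r s = 0
    · exact absurd hs (not_isTop_push hM τ)
    obtain ⟨τ', hτ', hs', rfl⟩ := ih ((isTop_push_iff hrs hM τ).1 hs)
    have hM' : M s r ≠ 0 := by rwa [M.symmetric]
    rw [isTop_push_iff (Ne.symm hrs) hM'] at hr
    exact ⟨push M r τ', .cons _ _ hτ' hr, by rwa [isTop_push_iff hrs hM], push_comm hrs hM _⟩

theorem Valid.mem_act {σ : B → List Bool} (hσ : Valid M σ) (s : B) : Valid M (act M s σ) := by
  by_cases hs : IsTop s σ
  · obtain ⟨τ, hτ, -, rfl⟩ := hσ.exists_eq_push hs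
    rwa [act_push]
  · rw [act_of_not_isTop hs]
    exact .cons _ _ hσ hs

theorem Valid.act_act {σ : B → List Bool} (hσ : Valid M σ) (s : B) :
    act M s (act M s σ) = σ := by
  by_cases hs : IsTop s σ
  · obtain ⟨τ, -, hs', rfl⟩ := hσ.exists_eq_push hs
    rw [act_push, act_of_not_isTop hs']
  · rw [act_of_not_isTop hs, act_push]

theorem isTop_act_iff {s t : B} (hne : t ≠ s) (h : M s t ≠ 0) (σ : B → List Bool) :
    IsTop t (act M s σ) ↔ IsTop t σ := by
  unfold act IsTop
  split_ifs <;> simp [push, pop, hne, h]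

theorem Valid.isTop_act_self {σ : B → List Bool} (hσ : Valid M σ) (s : B) :
    IsTop s (act M s σ) ↔ ¬ IsTop s σ := by
  by_cases hs : IsTop s σ
  · obtain ⟨τ, -, hs', rfl⟩ := hσ.exists_eq_push hs
    rw [act_push]
    tauto
  · rw [act_of_not_isTop hs]
    simp [hs, isTop_push_self]

theorem Valid.not_isTop {σ : B → List Bool} (hσ : Valid M σ) {s t : B} (h : M s t = 0)
    (hs : IsTop s σ) : ¬ IsTop t σ := by
  obtain ⟨τ, -, -, rfl⟩ := hσ.exists_eq_push hs
  exact not_isTop_push h τ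

theorem Valid.act_comm {σ : B → List Bool} (hσ : Valid M σ) {s t : B} (hne : t ≠ s)
    (h : M s t ≠ 0) :
    act M s (act M t σ) = act M t (act M s σ) := by
  have h' : M t s ≠ 0 := by rwa [M.symmetric]
  have key : ∀ {s t : B}, t ≠ s → M s t ≠ 0 → ∀ {σ : B → List Bool}, ¬ IsTop s σ → ¬ IsTop t σ →
      act M s (act M t σ) = push M s (push M t σ) := by
    intro s t hne h σ hs ht
    rw [act_of_not_isTop ht, act_of_not_isTop]
    rwa [isTop_push_iff hne.symm (by rwa [M.symmetric])]
  have mixed : ∀ {s t : B}, t ≠ s → M s t ≠ 0 → ∀ {σ : B → List Bool}, Valid M σ → IsTop s σ →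
      ¬ IsTop t σ →
      act M s (act M t σ) =
        act M t (act M s σ) := by
    intro s t hne h σ hσ hs ht
    rw [act_of_not_isTop ht]
    obtain ⟨τ, -, hs', rfl⟩ := hσ.exists_eq_push hs
    rw [isTop_push_iff hne h] at ht
    rw [push_comm hne.symm (by rwa [M.symmetric]), act_push, act_push, act_of_not_isTop ht]
  by_cases hs : IsTop s σ
  · by_cases ht : IsTop t σ
    · obtain ⟨τ, hτ, hs', rfl⟩ := hσ.exists_eq_push hs
      rw [isTop_push_iff hne h] at ht
      obtain ⟨ρ, -, ht', rfl⟩ := hτ.exists_eq_push ht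
      rw [act_push, act_push, push_comm hne h, act_push, act_push]
    · exact mixed hne h hσ hs ht
  · by_cases ht : IsTop t σ
    · exact (mixed hne.symm h' hσ ht hs).symm
    · rw [key hne h hs ht, key hne.symm h' ht hs, push_comm hne h]

variable (M) in
/-- The permutation of the valid pilings given by a generator. -/
noncomputable def actPerm (s : B) : Equiv.Perm {σ : B → List Bool // Valid M σ} where
  toFun σ := ⟨act M s σ.1, σ.2.mem_act s⟩
  invFun σ := ⟨act M s σ.1, σ.2.mem_act s⟩
  left_inv σ := Subtype.ext (σ.2.act_act s)
  right_inv σ := Subtype.ext (σ.2.act_act s)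

theorem isLiftable_actPerm (hra : M.IsRightAngled) : M.IsLiftable (actPerm M) := by
  intro s t
  have hsq : ∀ s, actPerm M s * actPerm M s = 1 := fun s =>
    Equiv.ext fun σ => Subtype.ext (σ.2.act_act s)
  by_cases hst : s = t
  · subst hst
    simp [hsq]
  rcases hra s t hst with h | h
  · have hc : actPerm M s * actPerm M t = actPerm M t * actPerm M s :=
      Equiv.ext fun σ => Subtype.ext (σ.2.act_comm (Ne.symm hst) (by simp [h]))
    rw [h, pow_two, mul_assoc, hc, ← mul_assoc (actPerm M t), hsq, one_mul, hsq]
  · simp [h]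

/-- Every right-angled Coxeter group admits a system of half-spaces, indexed by the generators. -/
theorem exists_halfspaces {W : Type*} [Group W] (cs : CoxeterSystem M W) (hra : M.IsRightAngled) :
    ∃ H : B → W → Prop, (∀ s, ¬ H s 1) ∧ (∀ s u, H s (cs.simple s * u) ↔ ¬ H s u) ∧
      (∀ s t u, t ≠ s → M s t ≠ 0 → (H t (cs.simple s * u) ↔ H t u)) ∧
      ∀ s t u, M s t = 0 → H s u → ¬ H t u := by
  let φ := cs.lift ⟨actPerm M, isLiftable_actPerm hra⟩
  have hφ : ∀ s u σ, (φ (cs.simple s * u) σ).1 = act M s (φ u σ).1 := by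
    intro s u σ
    rw [map_mul, cs.lift_apply_simple]
    rfl
  refine ⟨fun s u => IsTop s (φ u ⟨_, Valid.empty⟩).1, ?_, ?_, ?_, ?_⟩
  · intro s
    simp [IsTop]
  · intro s u
    simp only [hφ]
    exact Valid.isTop_act_self (φ u _).2 s
  · intro s t u hne h
    simp only [hφ]
    exact isTop_act_iff hne h _
  · intro s t u h
    exact Valid.not_isTop (φ u _).2 h

end Pilings

section Descents

variable {B W : Type*} [Group W] {M : CoxeterMatrix B} {cs : CoxeterSystem M W}

theorem simple_comm (hra : M.IsRightAngled) {s t : B} (h : M s t ≠ 0) :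
    cs.simple s * cs.simple t = cs.simple t * cs.simple s := by
  by_cases hst : s = t
  · rw [hst]
  have h2 := cs.simple_mul_simple_pow s t
  rw [(hra s t hst).resolve_right h, pow_two] at h2
  have h3 := eq_inv_of_mul_eq_one_left h2
  rwa [mul_inv_rev, cs.inv_simple, cs.inv_simple] at h3

variable (cs) in
/-- A system of half-spaces for the reflections in the generators. -/
structure HalfSpaces where
  /-- `H s u` says that `u` lies in the half-space of `s` that does not contain `1`. -/
  H : B → W → Prop
  not_one (s : B) : ¬ H s 1
  simple_self (s : B) (u : W) : H s (cs.simple s * u) ↔ ¬ H s u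
  simple_of_ne_zero (s t : B) (u : W) : t ≠ s → M s t ≠ 0 → (H t (cs.simple s * u) ↔ H t u)
  not_of_eq_zero (s t : B) (u : W) : M s t = 0 → H s u → ¬ H t u

namespace HalfSpaces

variable (h : HalfSpaces cs)

/-- The elements obtained from `1` by successive left multiplications that enter half-spaces. -/
inductive Pushed : W → Prop
  | one : Pushed 1
  | mul (s : B) (u : W) : Pushed u → ¬ h.H s u → Pushed (cs.simple s * u)

theorem pushed_simple_mul (hra : M.IsRightAngled) (s : B) {u : W} (hu : h.Pushed u) :
    h.Pushed (cs.simple s * u) := by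
  induction hu with
  | one => exact .mul _ _ .one (h.not_one s)
  | mul t u hu ht ih =>
    by_cases hs : h.H s (cs.simple t * u)
    · by_cases hst : s = t
      · subst hst
        simpa using hu
      by_cases hM : M t s = 0
      · exact absurd hs (h.not_of_eq_zero t s _ hM ((h.simple_self t u).2 ht))
      rw [← mul_assoc, simple_comm hra (by rwa [M.symmetric]), mul_assoc]
      refine .mul _ _ ih ?_
      rwa [h.simple_of_ne_zero s t u (Ne.symm hst) (by rwa [M.symmetric])]
    · exact .mul _ _ (.mul _ _ hu ht) hs

theorem pushed (hra : M.IsRightAngled) (u : W) : h.Pushed u :=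
  cs.simple_induction_left u .one fun _ s hu => h.pushed_simple_mul hra s hu

theorem simple_ne (h : HalfSpaces cs) {s t : B} (hM : M s t = 0) :
    cs.simple s ≠ cs.simple t := by
  intro hst
  have hs := (h.simple_self s 1).2 (h.not_one s)
  have ht := (h.simple_self t 1).2 (h.not_one t)
  rw [hst] at hs
  exact h.not_of_eq_zero s t _ hM hs ht

/-- An edge of the Cayley graph crossing a wall determines the reflection in this wall. -/
theorem simple_mul_eq_mul_simple (hra : M.IsRightAngled) (u : W) :
    ∀ s r, (h.H s u ↔ ¬ h.H s (u * cs.simple r)) → cs.simple s * u = u * cs.simple r := by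
  induction h.pushed hra u with
  | one =>
    intro s r hsr
    by_cases hrs : s = r
    · simp [hrs]
    exfalso
    have hs : h.H s (cs.simple r * 1) := by
      have := h.not_one s
      simp only [one_mul] at hsr
      simpa using by tauto
    by_cases hM : M r s = 0
    · exact h.not_of_eq_zero r s _ hM ((h.simple_self r 1).2 (h.not_one r)) hs
    · rw [h.simple_of_ne_zero r s 1 hrs hM] at hs
      exact h.not_one s hs
  | mul t u hu ht ih =>
    intro s r hsr
    rw [mul_assoc] at hsr ⊢
    by_cases hst : s = t
    · subst hst
      rw [h.simple_self, h.simple_self] at hsr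
      rw [ih s r (by tauto)]
    by_cases hM : M t s = 0
    · exfalso
      have ht1 := (h.simple_self t u).2 ht
      have hs1 := h.not_of_eq_zero t s _ hM ht1
      have hs2 : h.H s (cs.simple t * (u * cs.simple r)) := by tauto
      have ht2 := h.not_of_eq_zero s t _ (by rwa [M.symmetric]) hs2
      rw [h.simple_self, not_not] at ht2
      have e1 := ih t r (by tauto)
      rw [← e1, cs.simple_mul_simple_cancel_left] at hs2
      rw [e1] at hs1
      have e2 := ih s r (by tauto)
      exact h.simple_ne hM (mul_right_cancel (e1.trans e2.symm))
    · rw [h.simple_of_ne_zero t s _ hst hM, h.simple_of_ne_zero t s _ hst hM] at hsr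
      rw [← mul_assoc, simple_comm hra (by rwa [M.symmetric]), mul_assoc, ih s r hsr]

theorem exists_shorter (hra : M.IsRightAngled) (s : B) (l : List B) :
    h.H s (cs.wordProd l) →
      ∃ l' : List B, l'.length < l.length ∧ cs.wordProd l' = cs.simple s * cs.wordProd l := by
  induction l using List.reverseRecOn with
  | nil =>
    intro hs
    rw [cs.wordProd_nil] at hs
    exact absurd hs (h.not_one s)
  | append_singleton l r ih =>
    intro hs
    rw [cs.wordProd_append, cs.wordProd_singleton] at hs ⊢
    by_cases hs' : h.H s (cs.wordProd l)
    · obtain ⟨l', hl, hl'⟩ := ih hs'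
      refine ⟨l' ++ [r], by simpa using hl, ?_⟩
      rw [cs.wordProd_append, cs.wordProd_singleton, hl', mul_assoc]
    · refine ⟨l, by simp, ?_⟩
      rw [← mul_assoc, h.simple_mul_eq_mul_simple hra _ s r (by tauto)]
      simp

theorem iff_isLeftDescent (hra : M.IsRightAngled) (s : B) (u : W) :
    h.H s u ↔ cs.IsLeftDescent u s := by
  have key : ∀ u, h.H s u → cs.IsLeftDescent u s := by
    intro u hu
    obtain ⟨l, hl, rfl⟩ := cs.exists_isReduced u
    obtain ⟨l', hlt, hl'⟩ := h.exists_shorter hra s l hu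
    rw [CoxeterSystem.IsLeftDescent, ← hl', hl.eq]
    exact (cs.length_wordProd_le l').trans_lt hlt
  refine ⟨key u, fun hu => ?_⟩
  by_contra hs
  have := key _ ((h.simple_self s u).2 hs)
  rw [cs.isLeftDescent_iff_not_isLeftDescent_mul] at hu
  exact hu this

end HalfSpaces

/-- The half-spaces of a right-angled Coxeter group, given by left descents. -/
theorem exists_isLeftDescent_halfSpaces (cs : CoxeterSystem M W) (hra : M.IsRightAngled) :
    ∃ h : HalfSpaces cs, h.H = fun s u => cs.IsLeftDescent u s := by
  obtain ⟨H, h1, h2, h3, h4⟩ := exists_halfspaces cs hra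
  exact ⟨⟨H, h1, h2, h3, h4⟩, by
    funext s u
    exact propext (HalfSpaces.iff_isLeftDescent ⟨H, h1, h2, h3, h4⟩ hra s u)⟩

theorem isLeftDescent_simple_mul_self {s : B} {u : W} :
    cs.IsLeftDescent (cs.simple s * u) s ↔ ¬ cs.IsLeftDescent u s := by
  rw [cs.isLeftDescent_iff_not_isLeftDescent_mul (w := u), not_not]

theorem isLeftDescent_simple_mul (hra : M.IsRightAngled) {s t : B} {u : W} (hne : t ≠ s)
    (hM : M s t ≠ 0) :
    cs.IsLeftDescent (cs.simple s * u) t ↔ cs.IsLeftDescent u t := by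
  obtain ⟨h, hh⟩ := exists_isLeftDescent_halfSpaces cs hra
  simpa [hh] using h.simple_of_ne_zero s t u hne hM

theorem not_isLeftDescent (hra : M.IsRightAngled) {s t : B} {u : W} (hM : M s t = 0)
    (hs : cs.IsLeftDescent u s) :
    ¬ cs.IsLeftDescent u t := by
  obtain ⟨h, hh⟩ := exists_isLeftDescent_halfSpaces cs hra
  simpa [hh] using h.not_of_eq_zero s t u hM (by simpa [hh] using hs)

theorem simple_ne (cs : CoxeterSystem M W) (hra : M.IsRightAngled) {s t : B} (hM : M s t = 0) :
    cs.simple s ≠ cs.simple t := by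
  obtain ⟨h, -⟩ := exists_isLeftDescent_halfSpaces cs hra
  exact h.simple_ne hM

/-- An edge of the Cayley graph crossing a wall determines the reflection in this wall. -/
theorem simple_mul_eq_mul_simple (hra : M.IsRightAngled) {u : W} {s r : B}
    (hsr : cs.IsLeftDescent u s ↔ ¬ cs.IsLeftDescent (u * cs.simple r) s) :
    cs.simple s * u = u * cs.simple r := by
  obtain ⟨h, hh⟩ := exists_isLeftDescent_halfSpaces cs hra
  exact h.simple_mul_eq_mul_simple hra u s r (by simpa [hh] using hsr)

end Descents

section Separation

variable {B W : Type*} [Group W] {M : CoxeterMatrix B} {cs : CoxeterSystem M W}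

theorem eq_one_of_forall_commute (hra : M.IsRightAngled) (hadj : ∀ s, ∃ t, M s t = 0) {z : W}
    (hz : ∀ s, Commute z (cs.simple s)) : z = 1 := by
  by_contra hne
  obtain ⟨s, hs⟩ := cs.exists_leftDescent_of_ne_one hne
  obtain ⟨t, hM⟩ := hadj s
  have ht : cs.IsLeftDescent (z * cs.simple t) t := by
    rw [(hz t).eq, isLeftDescent_simple_mul_self]
    exact not_isLeftDescent hra hM hs
  have hs' := not_isLeftDescent hra (by rwa [M.symmetric]) ht (t := s)
  have e := simple_mul_eq_mul_simple hra (iff_of_true hs hs')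
  rw [(hz t).eq] at e
  exact simple_ne cs hra hM (mul_right_cancel e)

variable (cs) in
/-- The reflections whose walls separate `u` from `v`. -/
def separating (u v : W) : Set W :=
  {ρ | ∃ z s, ρ = z * cs.simple s * z⁻¹ ∧
    ¬ (cs.IsLeftDescent (z⁻¹ * u) s ↔ cs.IsLeftDescent (z⁻¹ * v) s)}

theorem finite_separating (hra : M.IsRightAngled) (u v : W) : (separating cs u v).Finite := by
  have key : ∀ x : W, (separating cs u (u * x)).Finite := by
    intro x
    induction x using cs.simple_induction_right with
    | one => simp [separating]
    | mul_simple_right x r ih =>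
      refine (ih.union (Set.finite_singleton (u * x * cs.simple r * (u * x)⁻¹))).subset ?_
      rintro ρ ⟨z, s, rfl, hsep⟩
      by_cases h : cs.IsLeftDescent (z⁻¹ * u) s ↔ cs.IsLeftDescent (z⁻¹ * (u * x)) s
      · right
        have e := simple_mul_eq_mul_simple hra (cs := cs) (u := z⁻¹ * (u * x)) (s := s) (r := r)
          (by simp only [mul_assoc] at hsep h ⊢; tauto)
        have e' : cs.simple s = z⁻¹ * (u * x) * cs.simple r * (z⁻¹ * (u * x))⁻¹ :=
          eq_mul_inv_of_mul_eq e
        rw [e']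
        simp only [Set.mem_singleton_iff]
        group
      · exact Or.inl ⟨z, s, rfl, h⟩
  simpa using key (u⁻¹ * v)

end Separation

section Centralizer

variable {B W : Type*} [Group W] {M : CoxeterMatrix B} {cs : CoxeterSystem M W}
  {g z : W} {t : B}

theorem isLeftDescent_conj_mul (v : W) :
    cs.IsLeftDescent (z⁻¹ * (z * cs.simple t * z⁻¹ * v)) t ↔ ¬ cs.IsLeftDescent (z⁻¹ * v) t := by
  rw [← isLeftDescent_simple_mul_self]
  simp [mul_assoc]

theorem isLeftDescent_pow_mul
    (hg : ∀ v, cs.IsLeftDescent (z⁻¹ * v) t → cs.IsLeftDescent (z⁻¹ * (g * v)) t) (k : ℕ) {v : W}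
    (hv : cs.IsLeftDescent (z⁻¹ * v) t) : cs.IsLeftDescent (z⁻¹ * (g ^ k * v)) t := by
  induction k with
  | zero => simpa using hv
  | succ k ih =>
    rw [pow_succ', mul_assoc g]
    exact hg _ ih

/-- If `g` maps a half-space properly into itself, then no nontrivial power of `g` commutes with
the reflection in its wall. -/
theorem not_commute_pow
    (hg : ∀ v, cs.IsLeftDescent (z⁻¹ * v) t → cs.IsLeftDescent (z⁻¹ * (g * v)) t) {x : W}
    (hx : cs.IsLeftDescent (z⁻¹ * x) t) (hx' : ¬ cs.IsLeftDescent (z⁻¹ * (g⁻¹ * x)) t) (k : ℕ) :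
    ¬ Commute (g ^ (k + 1)) (z * cs.simple t * z⁻¹) := by
  intro hc
  have h1 : ¬ cs.IsLeftDescent (z⁻¹ * ((g ^ (k + 1))⁻¹ * x)) t := by
    intro h1
    apply hx'
    have := isLeftDescent_pow_mul hg k h1
    rwa [pow_succ', mul_inv_rev, mul_assoc, mul_inv_cancel_left] at this
  rw [← isLeftDescent_conj_mul] at h1
  have h2 := isLeftDescent_pow_mul hg (k + 1) h1
  rw [← mul_assoc (g ^ (k + 1)), hc.eq, mul_assoc (z * cs.simple t * z⁻¹), mul_inv_cancel_left,
    isLeftDescent_conj_mul] at h2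
  exact h2 hx

theorem finite_setOf_zpow_separates (hra : M.IsRightAngled)
    (hg : ∀ v, cs.IsLeftDescent (z⁻¹ * v) t → cs.IsLeftDescent (z⁻¹ * (g * v)) t) {x : W}
    (hx : cs.IsLeftDescent (z⁻¹ * x) t) (hx' : ¬ cs.IsLeftDescent (z⁻¹ * (g⁻¹ * x)) t) (u v : W) :
    {k : ℤ | ¬ (cs.IsLeftDescent (z⁻¹ * (g ^ k * u)) t ↔
      cs.IsLeftDescent (z⁻¹ * (g ^ k * v)) t)}.Finite := by
  refine Set.Finite.of_finite_image (f := fun k : ℤ => (g ^ k)⁻¹ * (z * cs.simple t * z⁻¹) * g ^ k)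
    ((finite_separating (cs := cs) hra u v).subset ?_) ?_
  · rintro _ ⟨k, hk, rfl⟩
    refine ⟨(g ^ k)⁻¹ * z, t, by simp [mul_assoc], ?_⟩
    simpa [mul_assoc] using hk
  · have key : ∀ m n : ℤ, m < n → (g ^ m)⁻¹ * (z * cs.simple t * z⁻¹) * g ^ m ≠
        (g ^ n)⁻¹ * (z * cs.simple t * z⁻¹) * g ^ n := by
      intro m n hmn heq
      obtain ⟨k, rfl⟩ : ∃ k : ℕ, n = (k + 1 : ℕ) + m := ⟨(n - m - 1).toNat, by omega⟩
      apply not_commute_pow hg hx hx' k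
      rw [zpow_add, zpow_natCast] at heq
      rw [Commute, SemiconjBy]
      generalize z * cs.simple t * z⁻¹ = ρ at heq ⊢
      generalize g ^ (k + 1) = y at heq ⊢
      generalize g ^ m = x at heq
      have h1 : y * (x * (x⁻¹ * ρ * x) * x⁻¹) = y * (x * ((y * x)⁻¹ * ρ * (y * x)) * x⁻¹) := by
        rw [heq]
      simpa [mul_assoc] using h1
    intro m _ n _ heq
    rcases lt_trichotomy m n with h | h | h
    · exact absurd heq (key m n h)
    · exact h
    · exact absurd heq.symm (key n m h)

theorem exists_zpow_mul_isLeftDescent (hra : M.IsRightAngled)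
    (hg : ∀ v, cs.IsLeftDescent (z⁻¹ * v) t → cs.IsLeftDescent (z⁻¹ * (g * v)) t) {x : W}
    (hx : cs.IsLeftDescent (z⁻¹ * x) t) (hx' : ¬ cs.IsLeftDescent (z⁻¹ * (g⁻¹ * x)) t) (h : W) :
    ∃ n : ℤ, cs.IsLeftDescent (z⁻¹ * (g ^ n * h)) t ∧
      ¬ cs.IsLeftDescent (z⁻¹ * (g⁻¹ * (g ^ n * h))) t := by
  have up : ∀ (y : W) (n : ℤ) (k : ℕ), cs.IsLeftDescent (z⁻¹ * (g ^ n * y)) t →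
      cs.IsLeftDescent (z⁻¹ * (g ^ (n + k) * y)) t := by
    intro y n k hy
    rw [add_comm, zpow_add, zpow_natCast, mul_assoc]
    exact isLeftDescent_pow_mul hg k hy
  have hfin := fun y => finite_setOf_zpow_separates hra hg hx hx' h y
  obtain ⟨n, hn⟩ : ∃ n : ℤ, cs.IsLeftDescent (z⁻¹ * (g ^ n * h)) t := by
    by_contra! hcon
    refine Set.Ici_infinite (0 : ℤ) ((hfin x).subset fun k hk => ?_)
    have h1 := up x 0 k.toNat (by simpa using hx)
    rw [zero_add, Int.toNat_of_nonneg hk] at h1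
    have := hcon k
    simp only [Set.mem_ofPred_eq]
    tauto
  obtain ⟨m, hm⟩ : ∃ m : ℤ, ¬ cs.IsLeftDescent (z⁻¹ * (g ^ m * h)) t := by
    by_contra! hcon
    refine Set.Iic_infinite (0 : ℤ) ((hfin (g⁻¹ * x)).subset fun k hk => ?_)
    have h1 : ¬ cs.IsLeftDescent (z⁻¹ * (g ^ k * (g⁻¹ * x))) t := by
      intro h1
      have h2 := up _ k (-k).toNat h1
      rw [Int.toNat_of_nonneg (by simpa using hk), add_neg_cancel, zpow_zero, one_mul] at h2
      exact hx' h2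
    have := hcon k
    simp only [Set.mem_ofPred_eq]
    tauto
  by_contra! hcon
  have down : ∀ k : ℕ, cs.IsLeftDescent (z⁻¹ * (g ^ (n - k) * h)) t := by
    intro k
    induction k with
    | zero => simpa using hn
    | succ k ih =>
      have h1 := hcon _ ih
      rw [← mul_assoc g⁻¹, ← zpow_neg_one g, ← zpow_add] at h1
      convert h1 using 5
      push_cast
      ring
  apply hm
  rcases le_total n m with hnm | hnm
  · have := up h n (m - n).toNat hn
    rwa [Int.toNat_of_nonneg (by omega), add_sub_cancel] at this
  · have := down (n - m).toNat
    rwa [Int.toNat_of_nonneg (by omega), sub_sub_cancel] at this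

/-- Suppose that `g` maps a half-space properly into itself, and that between this half-space and
its translate by `g⁻¹` there are half-spaces whose reflections have trivial common centralizer.
Then the centralizer of `g` is virtually infinite cyclic. -/
theorem mem_algA_one (hra : M.IsRightAngled)
    (hg : ∀ v, cs.IsLeftDescent (z⁻¹ * v) t → cs.IsLeftDescent (z⁻¹ * (g * v)) t) {x : W}
    (hx : cs.IsLeftDescent (z⁻¹ * x) t) (hx' : ¬ cs.IsLeftDescent (z⁻¹ * (g⁻¹ * x)) t)
    {T : Set W} (hTfin : T.Finite) (hT : ∀ ρ ∈ T, ∃ y s, ρ = y * cs.simple s * y⁻¹ ∧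
      (∀ v, cs.IsLeftDescent (z⁻¹ * v) t → cs.IsLeftDescent (y⁻¹ * v) s) ∧
      ∀ v, cs.IsLeftDescent (y⁻¹ * v) s → cs.IsLeftDescent (z⁻¹ * (g * v)) t)
    (hcent : ∀ k : W, (∀ ρ ∈ T, Commute k ρ) → k = 1) : g ∈ algA W 1 := by
  let D : Set W := {h | Commute h g ∧ cs.IsLeftDescent (z⁻¹ * h) t ∧
    ¬ cs.IsLeftDescent (z⁻¹ * (g⁻¹ * h)) t}
  have hDsep : ∀ h ∈ D, ∀ ρ ∈ T, h⁻¹ * ρ * h ∈ separating cs 1 (g⁻¹ * g⁻¹) := by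
    rintro h ⟨hc, h1, h2⟩ ρ hρ
    obtain ⟨y, s, rfl, hy1, hy2⟩ := hT ρ hρ
    refine ⟨h⁻¹ * y, s, by simp [mul_assoc], ?_⟩
    have h3 := hy1 h h1
    have h4 : ¬ cs.IsLeftDescent (y⁻¹ * (g⁻¹ * (g⁻¹ * h))) s := by
      intro h4
      have := hy2 _ h4
      rw [mul_inv_cancel_left] at this
      exact h2 this
    have e : (h⁻¹ * y)⁻¹ * (g⁻¹ * g⁻¹) = y⁻¹ * (g⁻¹ * (g⁻¹ * h)) := by
      rw [mul_inv_rev, inv_inv, mul_assoc, (hc.inv_right.mul_right hc.inv_right).eq]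
      simp only [mul_assoc]
    rw [e, mul_one, mul_inv_rev, inv_inv]
    tauto
  have hDfin : Finite D := by
    have := hTfin.to_subtype
    have := (finite_separating (cs := cs) hra 1 (g⁻¹ * g⁻¹)).to_subtype
    refine Finite.of_injective (β := T → separating cs 1 (g⁻¹ * g⁻¹))
      (fun h ρ => ⟨_, hDsep h.1 h.2 ρ.1 ρ.2⟩) ?_
    rintro ⟨h, hh⟩ ⟨h', hh'⟩ heq
    refine Subtype.ext (mul_inv_eq_one.1 (hcent _ fun ρ hρ => ?_))
    have e : h⁻¹ * ρ * h = h'⁻¹ * ρ * h' := congrArg Subtype.val (congrFun heq ⟨ρ, hρ⟩)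
    have e' : h * (h⁻¹ * ρ * h) * h'⁻¹ = h * (h'⁻¹ * ρ * h') * h'⁻¹ := by rw [e]
    rw [Commute, SemiconjBy]
    simpa [mul_assoc] using e'.symm
  let g' : Subgroup.centralizer ({g} : Set W) :=
    ⟨g, by simp [Subgroup.mem_centralizer_singleton_iff]⟩
  have hinj : Function.Injective fun n : ℤ => g' ^ n := by
    rw [injective_zpow_iff_not_isOfFinOrder, isOfFinOrder_iff_pow_eq_one]
    rintro ⟨n, hn, hpow⟩
    obtain ⟨k, rfl⟩ : ∃ k, n = k + 1 := ⟨n - 1, by omega⟩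
    refine not_commute_pow hg hx hx' k ?_
    have : g ^ (k + 1) = 1 := congrArg Subtype.val hpow
    rw [this]
    exact Commute.one_left _
  refine ⟨Subgroup.zpowers g', ?_, 1, le_rfl, ?_⟩
  · have hsurj : Function.Surjective fun h : D =>
        ((⟨h.1, Subgroup.mem_centralizer_singleton_iff.2 h.2.1.eq⟩ :
          Subgroup.centralizer ({g} : Set W)) :
          Subgroup.centralizer ({g} : Set W) ⧸ Subgroup.zpowers g') := by
      intro q
      obtain ⟨⟨c, hc⟩, rfl⟩ := QuotientGroup.mk_surjective q
      have hc' : Commute c g := Subgroup.mem_centralizer_singleton_iff.1 hc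
      obtain ⟨n, hn1, hn2⟩ := exists_zpow_mul_isLeftDescent hra hg hx hx' c
      refine ⟨⟨g ^ n * c, ((Commute.refl g).zpow_left n).mul_left hc', hn1, hn2⟩, ?_⟩
      rw [eq_comm, QuotientGroup.eq]
      refine ⟨n, Subtype.ext ?_⟩
      change g ^ n = c⁻¹ * (g ^ n * c)
      rw [← (hc'.zpow_right n).eq, inv_mul_cancel_left]
    have := Finite.of_surjective _ hsurj
    exact Subgroup.finiteIndex_of_finite_quotient
  · let e : Multiplicative ℤ ≃* Subgroup.zpowers g' :=
      MulEquiv.ofBijective ((zpowersHom _ g').rangeRestrict)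
        ⟨fun a b hab => by
          have := congrArg Subtype.val hab
          exact hinj this, MonoidHom.rangeRestrict_surjective _⟩
    exact ⟨e.symm.trans (AddEquiv.toMultiplicative (AddEquiv.funUnique (Fin 1) ℤ).symm)⟩

end Centralizer

section Words

variable {B W : Type*} [Group W] {M : CoxeterMatrix B} {cs : CoxeterSystem M W}

/-- Multiplying `v`, whose only left descent is `a`, by `w` on the left without cancelling `a`
creates no left descents except for those of `w` and possibly for the conjugate of `a`. -/
theorem isLeftDescent_mul (hra : M.IsRightAngled) {v : W} {a : B}
    (hv : ∀ t, cs.IsLeftDescent v t → t = a) (w : W) (hw : ¬ cs.IsRightDescent w a) :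
    ∀ t, cs.IsLeftDescent (w * v) t →
      cs.IsLeftDescent w t ∨ cs.simple t * w = w * cs.simple a := by
  induction hn : cs.length w generalizing w with
  | zero =>
    intro t ht
    rw [cs.length_eq_zero_iff] at hn
    subst hn
    rw [one_mul] at ht
    simp [hv t ht]
  | succ n ih =>
    intro t ht
    have hne : w ≠ 1 := by
      rintro rfl
      simp at hn
    obtain ⟨r, hr⟩ := cs.exists_leftDescent_of_ne_one hne
    obtain ⟨w', rfl⟩ : ∃ w', w = cs.simple r * w' := ⟨cs.simple r * w, by simp⟩
    have hr' := isLeftDescent_simple_mul_self.1 hr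
    have hlen := cs.not_isLeftDescent_iff.1 hr'
    rw [cs.not_isRightDescent_iff] at hw
    have hw' : ¬ cs.IsRightDescent w' a := by
      intro h
      rw [cs.isRightDescent_iff] at h
      have h1 := cs.length_simple_mul (w' * cs.simple a) r
      rw [← mul_assoc] at h1
      omega
    have ihw := ih w' hw' (by omega)
    have hrv : ¬ cs.IsLeftDescent (w' * v) r := by
      intro h
      rcases ihw r h with h1 | h1
      · exact hr' h1
      · rw [h1, cs.simple_mul_simple_cancel_right] at hw
        rw [h1] at hlen
        omega
    rw [mul_assoc] at ht
    by_cases htr : t = r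
    · exact Or.inl (htr ▸ hr)
    by_cases hM : M r t = 0
    · exact absurd ht (not_isLeftDescent hra hM (isLeftDescent_simple_mul_self.2 hrv))
    rw [isLeftDescent_simple_mul hra htr hM] at ht ⊢
    refine (ihw t ht).imp_right fun h => ?_
    rw [← mul_assoc, ← simple_comm hra hM, mul_assoc, h, mul_assoc]

theorem exists_not_isLeftDescent (hra : M.IsRightAngled) {s t : B} (hM : M s t = 0) (w : W)
    (a : B) : ∃ b, ¬ cs.IsLeftDescent w b ∧ cs.simple b * w ≠ w * cs.simple a := by
  have key : ∀ s t, M s t = 0 → cs.IsLeftDescent w s →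
      ¬ cs.IsLeftDescent w t ∧ cs.simple t * w ≠ w * cs.simple a := by
    intro s t hM hs
    have ht := not_isLeftDescent hra hM hs
    refine ⟨ht, fun heq => ?_⟩
    have hs' := not_isLeftDescent hra (by rwa [M.symmetric])
      (isLeftDescent_simple_mul_self.2 ht) (t := s)
    rw [heq] at hs'
    have e := simple_mul_eq_mul_simple hra (iff_of_true hs hs')
    exact simple_ne cs hra hM (mul_right_cancel (e.trans heq.symm))
  by_cases hs : cs.IsLeftDescent w s
  · exact ⟨t, key s t hM hs⟩
  by_cases ht : cs.IsLeftDescent w t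
  · exact ⟨s, key t s (by rwa [M.symmetric]) ht⟩
  by_cases hsw : cs.simple s * w = w * cs.simple a
  · refine ⟨t, ht, fun htw => ?_⟩
    exact simple_ne cs hra hM (mul_right_cancel (hsw.trans htw.symm))
  · exact ⟨s, hs, hsw⟩

theorem isLeftDescent_wordProd_mul (hra : M.IsRightAngled) {u : W} {c : B}
    (hu : cs.IsLeftDescent u c) (l : List B) (hl : (l ++ [c]).IsChain fun s t => M s t = 0) :
    ∀ a, (l ++ [c]).head? = some a → cs.IsLeftDescent (cs.wordProd l * u) a ∧
      ∀ t, cs.IsLeftDescent (cs.wordProd l * u) t → t = a ∨ t ∉ l := by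
  induction l with
  | nil =>
    intro a ha
    obtain rfl : c = a := by simpa using ha
    simpa using hu
  | cons x l ih =>
    intro a ha
    obtain rfl : x = a := by simpa using ha
    obtain ⟨y, hy⟩ : ∃ y, (l ++ [c]).head? = some y := by cases l <;> simp
    rw [List.cons_append, List.isChain_cons] at hl
    have hxy := hl.1 y hy
    obtain ⟨h1, h2⟩ := ih hl.2 y hy
    have hx : cs.IsLeftDescent (cs.simple x * (cs.wordProd l * u)) x :=
      isLeftDescent_simple_mul_self.2 (not_isLeftDescent hra (by rwa [M.symmetric]) h1)
    rw [cs.wordProd_cons, mul_assoc]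
    refine ⟨hx, fun t ht => ?_⟩
    by_cases htx : t = x
    · exact Or.inl htx
    have hM : M x t ≠ 0 := fun hM => not_isLeftDescent hra hM hx ht
    rw [isLeftDescent_simple_mul hra htx hM] at ht
    rcases h2 t ht with rfl | h3
    · exact absurd hxy hM
    · right
      simp [htx, h3]

theorem isLeftDescent_head (hra : M.IsRightAngled) {b : B} (q : List B)
    (hq : q.IsChain fun s t => M s t = 0) (hb : q.getLast? = some b) :
    ∀ c, q.head? = some c → ∀ v, ¬ cs.IsLeftDescent ((cs.wordProd q)⁻¹ * v) b →
      cs.IsLeftDescent v c := by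
  induction q with
  | nil => simp at hb
  | cons x q ih =>
    intro c hc v hv
    obtain rfl : x = c := by simpa using hc
    rw [cs.wordProd_cons, mul_inv_rev, cs.inv_simple, mul_assoc] at hv
    rcases q with _ | ⟨y, q⟩
    · obtain rfl : x = b := by simpa using hb
      simpa [isLeftDescent_simple_mul_self] using hv
    · rw [List.isChain_cons_cons] at hq
      have h1 := ih hq.2 (by simpa using hb) y (by simp) _ hv
      have h2 := not_isLeftDescent hra (by rw [M.symmetric]; exact hq.1) h1 (t := x) (s := y)
      simpa [isLeftDescent_simple_mul_self] using h2

theorem exists_halfspace_between (hra : M.IsRightAngled) {b : B} (q : List B)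
    (hq : q.IsChain fun s t => M s t = 0) (hb : q.getLast? = some b) :
    ∀ c, q.head? = some c → ∀ ρ ∈ cs.leftInvSeq q, ∃ y s, ρ = y * cs.simple s * y⁻¹ ∧
      (∀ v, ¬ cs.IsLeftDescent ((cs.wordProd q)⁻¹ * v) b → cs.IsLeftDescent (y⁻¹ * v) s) ∧
      ∀ v, cs.IsLeftDescent (y⁻¹ * v) s → cs.IsLeftDescent v c := by
  induction q with
  | nil => simp at hb
  | cons x q ih =>
    intro c hc ρ hρ
    obtain rfl : x = c := by simpa using hc
    rw [CoxeterSystem.leftInvSeq, List.mem_cons] at hρ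
    rcases hρ with rfl | hρ
    · refine ⟨1, x, by simp, fun v hv => ?_, fun v hv => by simpa using hv⟩
      simpa using isLeftDescent_head hra _ hq hb x hc v hv
    obtain ⟨ρ', hρ', rfl⟩ := List.mem_map.1 hρ
    rcases q with _ | ⟨z, q⟩
    · simp at hρ'
    rw [List.isChain_cons_cons] at hq
    obtain ⟨y, s, rfl, h1, h2⟩ := ih hq.2 (by simpa using hb) z (by simp) ρ' hρ'
    refine ⟨cs.simple x * y, s, by simp [mul_assoc], fun v hv => ?_, fun v hv => ?_⟩
    · rw [mul_inv_rev, mul_assoc]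
      apply h1
      rwa [cs.wordProd_cons, mul_inv_rev, mul_assoc] at hv
    · rw [mul_inv_rev, cs.inv_simple, mul_assoc] at hv
      have h3 := not_isLeftDescent hra (by rw [M.symmetric]; exact hq.1) (h2 _ hv) (t := x)
      simpa [isLeftDescent_simple_mul_self] using h3

theorem commute_of_forall_mem_leftInvSeq (z : W) (q : List B)
    (hz : ∀ ρ ∈ cs.leftInvSeq q, Commute z ρ) : ∀ s ∈ q, Commute z (cs.simple s) := by
  induction q with
  | nil => simp
  | cons x q ih =>
    simp only [CoxeterSystem.leftInvSeq, List.mem_cons, List.mem_map, forall_eq_or_imp,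
      forall_exists_index, and_imp, forall_apply_eq_imp_iff₂, MulAut.conj_apply] at hz ⊢
    refine ⟨hz.1, ih fun ρ hρ => ?_⟩
    have h := (hz.1.mul_right (hz.2 ρ hρ)).mul_right hz.1
    simpa [mul_assoc] using h

/-- If `w` does not cancel with either end of a product `p` of two words in which consecutive
letters do not commute and every generator occurs, then the centralizer of `p * w` is virtually
infinite cyclic. -/
theorem wordProd_mul_mem_algA (hra : M.IsRightAngled) (hadj : ∀ s, ∃ t, M s t = 0)
    {l q : List B} {a b c : B} (hl : (l ++ [c]).IsChain fun s t => M s t = 0)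
    (hl' : ∀ s, s ∈ l) (ha : l.head? = some a) (hq : q.IsChain fun s t => M s t = 0)
    (hq' : ∀ s, s ∈ q) (hc : q.head? = some c) (hb : q.getLast? = some b) {w : W}
    (hwa : ¬ cs.IsRightDescent w a) (hwb : ¬ cs.IsLeftDescent w b)
    (hab : cs.simple b * w ≠ w * cs.simple a) :
    cs.wordProd l * cs.wordProd q * w ∈ algA W 1 := by
  set p := cs.wordProd l * cs.wordProd q with hp
  have hX : ∀ v, cs.IsLeftDescent ((p * cs.simple b)⁻¹ * v) b ↔
      ¬ cs.IsLeftDescent (p⁻¹ * v) b := by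
    intro v
    rw [mul_inv_rev, cs.inv_simple, mul_assoc, isLeftDescent_simple_mul_self]
  have hX₀ : ∀ v, cs.IsLeftDescent ((p * cs.simple b)⁻¹ * v) b →
      cs.IsLeftDescent ((cs.wordProd l)⁻¹ * v) c := by
    intro v hv
    rw [hX, hp, mul_inv_rev, mul_assoc] at hv
    exact isLeftDescent_head hra q hq hb c hc _ hv
  have hdesc : ∀ v, cs.IsLeftDescent ((cs.wordProd l)⁻¹ * v) c → cs.IsLeftDescent v a ∧
      ∀ t, cs.IsLeftDescent v t → t = a := by
    intro v hv
    have h := isLeftDescent_wordProd_mul hra hv l hl a (by simp [ha])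
    simpa [hl'] using h
  have hstep : ∀ v, cs.IsLeftDescent ((cs.wordProd l)⁻¹ * v) c →
      cs.IsLeftDescent ((p * cs.simple b)⁻¹ * (p * w * v)) b := by
    intro v hv
    rw [hX, mul_assoc, inv_mul_cancel_left]
    intro h
    exact (isLeftDescent_mul hra (hdesc v hv).2 w hwa b h).elim hwb hab
  refine mem_algA_one (z := p * cs.simple b) (t := b) (x := p)
    (T := {ρ | ∃ ρ' ∈ cs.leftInvSeq q, cs.wordProd l * ρ' * (cs.wordProd l)⁻¹ = ρ}) hra
    (fun v hv => hstep v (hX₀ v hv)) ?_ ?_ ?_ ?_ ?_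
  · rw [hX, inv_mul_cancel]
    exact cs.not_isLeftDescent_one b
  · rw [mul_inv_rev p w, inv_mul_cancel_right]
    intro h
    rw [← cs.isLeftDescent_inv_iff] at hwa
    exact hwa (hdesc _ (hX₀ _ h)).1
  · exact (List.finite_toSet (cs.leftInvSeq q)).image
      fun ρ' => cs.wordProd l * ρ' * (cs.wordProd l)⁻¹
  · rintro _ ⟨ρ', hρ', rfl⟩
    obtain ⟨y, s, rfl, h1, h2⟩ := exists_halfspace_between hra q hq hb c hc ρ' hρ'
    refine ⟨cs.wordProd l * y, s, by simp [mul_assoc], fun v hv => ?_, fun v hv => ?_⟩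
    · rw [hX, hp, mul_inv_rev, mul_assoc] at hv
      rw [mul_inv_rev, mul_assoc]
      exact h1 _ hv
    · rw [mul_inv_rev, mul_assoc] at hv
      exact hstep v (h2 _ hv)
  · intro k hk
    have h1 : (cs.wordProd l)⁻¹ * k * cs.wordProd l = 1 := by
      refine eq_one_of_forall_commute (cs := cs) hra hadj fun s =>
        commute_of_forall_mem_leftInvSeq _ q (fun ρ hρ => ?_) s (hq' s)
      have h2 := (hk _ ⟨ρ, hρ, rfl⟩).eq
      have h3 : ∀ x y : W, x = y → (cs.wordProd l)⁻¹ * x * cs.wordProd l =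
        (cs.wordProd l)⁻¹ * y * cs.wordProd l := by
        rintro x y rfl
        rfl
      rw [Commute, SemiconjBy]
      simpa [mul_assoc] using h3 _ _ h2
    rwa [mul_assoc, inv_mul_eq_one, right_eq_mul] at h1

end Words

section Graph

/-- The graph on the generators whose edges are the pairs of non-commuting generators. -/
def nonCommutingGraph {B : Type*} (M : CoxeterMatrix B) : SimpleGraph B where
  Adj s t := M s t = 0
  symm := ⟨fun s t h => by rwa [M.symmetric]⟩
  loopless := ⟨fun s h => by simp at h⟩

theorem preconnected_nonCommutingGraph {B W : Type*} [Group W] {M : CoxeterMatrix B}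
    (cs : CoxeterSystem M W) (hra : M.IsRightAngled) (hirr : cs.IsIrreducible) :
    (nonCommutingGraph M).Preconnected := by
  intro s t
  by_contra hst
  refine hirr ⟨{x | (nonCommutingGraph M).Reachable s x}, ⟨s, .refl s⟩, ⟨t, hst⟩, ?_⟩
  intro i hi j hj
  exact simple_comm hra fun hM => hj (hi.trans (SimpleGraph.Adj.reachable hM))

theorem exists_walk_forall_mem_support {V : Type*} [Finite V] {G : SimpleGraph V}
    (hG : G.Preconnected) (a b : V) : ∃ p : G.Walk a b, ∀ x, x ∈ p.support := by
  classical
  have := Fintype.ofFinite V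
  have key : ∀ T : Finset V, ∃ p : G.Walk a a, ∀ x ∈ T, x ∈ p.support := by
    intro T
    induction T using Finset.induction_on with
    | empty => exact ⟨.nil, by simp⟩
    | insert v T _ ih =>
      obtain ⟨p, hp⟩ := ih
      obtain ⟨r⟩ := hG a v
      refine ⟨p.append (r.append r.reverse), fun x hx => ?_⟩
      rw [SimpleGraph.Walk.mem_support_append_iff, SimpleGraph.Walk.mem_support_append_iff]
      rcases Finset.mem_insert.1 hx with rfl | hx
      · exact Or.inr (Or.inl r.end_mem_support)
      · exact Or.inl (hp x hx)
  obtain ⟨p, hp⟩ := key Finset.univ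
  obtain ⟨r⟩ := hG a b
  exact ⟨p.append r, fun x => SimpleGraph.Walk.mem_support_append_iff _ _ |>.2
    (Or.inl (hp x (Finset.mem_univ x)))⟩

end Graph

theorem nontrivial_of_infinite {B W : Type*} [Group W] {M : CoxeterMatrix B}
    (cs : CoxeterSystem M W) [Infinite W] : Nontrivial B := by
  by_contra hB
  rw [not_nontrivial_iff_subsingleton] at hB
  have hW : ∀ w : W, w = 1 ∨ w ∈ Set.range cs.simple := by
    intro w
    induction w using cs.simple_induction_left with
    | one => exact Or.inl rfl
    | mul_simple_left w i ih =>
      rcases ih with rfl | ⟨j, rfl⟩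
      · exact Or.inr ⟨i, by simp⟩
      · rw [Subsingleton.elim i j]
        simp
  have hfin : (Set.univ : Set W).Finite :=
    ((Set.finite_range cs.simple).insert 1).subset fun w _ => hW w
  exact Set.infinite_univ hfin

theorem algCovers_one {B W : Type*} [Finite B] [Group W] {M : CoxeterMatrix B}
    (cs : CoxeterSystem M W) (hra : M.IsRightAngled) [Infinite W] (hirr : cs.IsIrreducible) :
    algCovers W 1 := by
  classical
  have := Fintype.ofFinite B
  have := nontrivial_of_infinite cs
  have hG := preconnected_nonCommutingGraph cs hra hirr
  have hadj : ∀ s, ∃ t, M s t = 0 := fun s => hG.exists_adj_of_nontrivial s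
  have hP : ∀ a b : B, ∃ p : W, ∀ w : W, ¬ cs.IsRightDescent w a → ¬ cs.IsLeftDescent w b →
      cs.simple b * w ≠ w * cs.simple a → p * w ∈ algA W 1 := by
    intro a b
    obtain ⟨c, hc⟩ := hadj b
    obtain ⟨p, hp⟩ := exists_walk_forall_mem_support hG a b
    obtain ⟨q, hq⟩ := exists_walk_forall_mem_support hG c b
    refine ⟨_, fun w h1 h2 h3 => wordProd_mul_mem_algA hra hadj (l := p.support) (c := c)
      (q := q.support) ?_ hp ?_ q.isChain_adj_support hq ?_ ?_ h1 h2 h3⟩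
    · rw [List.isChain_append]
      refine ⟨p.isChain_adj_support, by simp, fun x hx y hy => ?_⟩
      rw [List.getLast?_eq_some_getLast p.support_ne_nil, SimpleGraph.Walk.getLast_support] at hx
      obtain rfl : b = x := by simpa using hx
      obtain rfl : c = y := by simpa using hy
      exact hc
    · rw [List.head?_eq_some_head p.support_ne_nil, SimpleGraph.Walk.head_support]
    · rw [List.head?_eq_some_head q.support_ne_nil, SimpleGraph.Walk.head_support]
    · rw [List.getLast?_eq_some_getLast q.support_ne_nil, SimpleGraph.Walk.getLast_support]
  choose P hP using hP
  refine ⟨Finset.univ.image fun x : B × B => (P x.1 x.2)⁻¹, ?_⟩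
  rw [Set.eq_univ_iff_forall]
  intro w
  obtain ⟨s⟩ : Nonempty B := inferInstance
  obtain ⟨t, hM⟩ := hadj s
  obtain ⟨a, ha⟩ : ∃ a, ¬ cs.IsRightDescent w a := by
    obtain ⟨a, ha, -⟩ := exists_not_isLeftDescent (cs := cs) hra hM w⁻¹ s
    exact ⟨a, by rwa [cs.isLeftDescent_inv_iff] at ha⟩
  obtain ⟨b, hb, hab⟩ := exists_not_isLeftDescent (cs := cs) hra hM w a
  simp only [Set.mem_iUnion]
  refine ⟨(P a b)⁻¹, Finset.mem_image.2 ⟨(a, b), Finset.mem_univ _, rfl⟩, ?_⟩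
  rw [Set.mem_smul_set_iff_inv_smul_mem, inv_inv, smul_eq_mul]
  exact hP a b w ha hb hab

end RightAngled

/-- For an infinite, irreducible, non-affine right-angled Coxeter group `W`,
`r(W) ≤ 1`: `W` is the union of finitely many left translates of `A₁(W)`. -/
theorem stmt_7 {B W : Type*} [Fintype B] [Group W] {M : CoxeterMatrix B}
    (cs : CoxeterSystem M W) (hra : M.IsRightAngled) [Infinite W]
    (hirr : cs.IsIrreducible) (hnaff : ¬ IsVirtuallyFreeAbelian W) :
    algr W ≤ 1 := by
  exact sInf_le ⟨1, rfl, RightAngled.algCovers_one cs hra hirr⟩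
end

section
/- Let (W,S) be an infinite, irreducible, non-affine right-angled Coxeter system with S finite. Let w be a reduced word over S in which every generator of S occurs and which is s-good for every s ∈ S. Then the element of W represented by w is essential. -/
namespace CoxeterSystem

variable {B : Type*} {W : Type*} [Group W] {M : CoxeterMatrix B} (cs : CoxeterSystem M W)

/-- A word is minimal if it is `s`-minimal for every generator `s`. -/
def IsMinimalWord (l : List B) : Prop := ∀ s, cs.SMinimal l s

variable {cs}

theorem IsBlocker.symm {s t : B} (h : cs.IsBlocker s t) : cs.IsBlocker t s :=
  fun h' => h (Commute.symm h')

theorem not_isBlocker_self (s : B) : ¬ cs.IsBlocker s s := fun h => h (Commute.refl _)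

theorem commute_wordProd {s : B} {l : List B} (h : ∀ t ∈ l, ¬ cs.IsBlocker s t) :
    Commute (cs.simple s) (cs.wordProd l) := by
  induction l with
  | nil => simp
  | cons a l ih =>
    rw [wordProd_cons]
    exact (not_not.1 (h a (by simp))).mul_right (ih fun t ht => h t (by simp [ht]))

/-- Two occurrences of `s` with no blocker between them cancel. -/
theorem wordProd_cancel {s : B} {l₁ l₂ l₃ : List B} (h : ∀ t ∈ l₂, ¬ cs.IsBlocker s t) :
    cs.wordProd (l₁ ++ s :: l₂ ++ s :: l₃) = cs.wordProd (l₁ ++ l₂ ++ l₃) := by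
  simp only [wordProd_append, wordProd_cons, mul_assoc]
  rw [← mul_assoc (cs.wordProd l₂) (cs.simple s), ← (commute_wordProd h).eq]
  simp [mul_assoc]

theorem ReducedWord.isMinimalWord {l : List B} (hl : cs.ReducedWord l) :
    cs.IsMinimalWord l := by
  rintro s l₁ l₂ l₃ rfl -
  by_contra! h
  simpa using hl _ (wordProd_cancel h).symm

theorem IsMinimalWord.of_cons {s : B} {l : List B} (h : cs.IsMinimalWord (s :: l)) :
    cs.IsMinimalWord l :=
  fun t l₁ l₂ l₃ hl ht => h t (s :: l₁) l₂ l₃ (by simp [hl]) ht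

variable (cs) in
open Classical in
/-- The action of a generator on the dual of the geometric representation. -/
noncomputable def dualReflection (s : B) (f : B → ℤ) : B → ℤ :=
  fun t => if t = s then -f s else if cs.IsBlocker s t then f t + 2 * f s else f t

theorem dualReflection_self (s : B) (f : B → ℤ) : cs.dualReflection s f s = -f s := by
  simp [dualReflection]

theorem dualReflection_of_isBlocker {s t : B} (h : cs.IsBlocker s t) (f : B → ℤ) :
    cs.dualReflection s f t = f t + 2 * f s := by
  have : t ≠ s := by rintro rfl; exact not_isBlocker_self _ h
  simp [dualReflection, this, h]

theorem dualReflection_of_not_isBlocker {s t : B} (hne : t ≠ s) (h : ¬ cs.IsBlocker s t)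
    (f : B → ℤ) : cs.dualReflection s f t = f t := by
  simp [dualReflection, hne, h]

theorem dualReflection_dualReflection (s : B) (f : B → ℤ) :
    cs.dualReflection s (cs.dualReflection s f) = f := by
  funext t
  by_cases hts : t = s
  · subst hts; simp [dualReflection_self]
  by_cases hb : cs.IsBlocker s t
  · simp [dualReflection_of_isBlocker hb, dualReflection_self]
  · simp [dualReflection_of_not_isBlocker hts hb]

theorem dualReflection_comm {s t : B} (hst : ¬ cs.IsBlocker s t) (f : B → ℤ) :
    cs.dualReflection s (cs.dualReflection t f) =
      cs.dualReflection t (cs.dualReflection s f) := by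
  by_cases hne : s = t
  · rw [hne]
  have hts : ¬ cs.IsBlocker t s := fun h => hst h.symm
  funext r
  by_cases hrs : r = s
  · subst hrs
    simp [dualReflection_self, dualReflection_of_not_isBlocker hne hts]
  by_cases hrt : r = t
  · subst hrt
    simp [dualReflection_self, dualReflection_of_not_isBlocker (Ne.symm hne) hst]
  simp only [dualReflection, hrs, hrt, hne, Ne.symm hne, hst, hts, if_false]
  split_ifs <;> ring

variable (cs) in
/-- `dualReflection` as an element of the monoid of self-maps of `B → ℤ`. -/
noncomputable def dualReflectionEnd (s : B) : Function.End (B → ℤ) := cs.dualReflection s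

theorem isLiftable_dualReflectionEnd (hra : M.IsRightAngled) :
    M.IsLiftable cs.dualReflectionEnd := by
  intro s t
  have hsq (s : B) : cs.dualReflectionEnd s * cs.dualReflectionEnd s = 1 :=
    funext (dualReflection_dualReflection (cs := cs) s)
  by_cases hne : s = t
  · subst hne
    simp [hsq]
  rcases hra s t hne with h | h
  · have hb : ¬ cs.IsBlocker s t := by
      have h2 := cs.simple_mul_simple_pow s t
      rw [h, pow_two, mul_eq_one_iff_eq_inv] at h2
      simpa [IsBlocker, Commute, SemiconjBy] using h2
    have hc : cs.dualReflectionEnd s * cs.dualReflectionEnd t =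
        cs.dualReflectionEnd t * cs.dualReflectionEnd s := funext (dualReflection_comm hb)
    rw [h, pow_two]
    nth_rw 1 [hc]
    rw [mul_assoc, ← mul_assoc (cs.dualReflectionEnd s), hsq, one_mul, hsq]
  · rw [h, pow_zero]

/-- The coordinates of the image of the all-ones vector under an element of `W` acting on the
dual of the geometric representation. -/
noncomputable def chamberCoord (hra : M.IsRightAngled) (w : W) : B → ℤ :=
  cs.lift ⟨_, isLiftable_dualReflectionEnd (cs := cs) hra⟩ w (fun _ => 1)

theorem chamberCoord_one (hra : M.IsRightAngled) :
    cs.chamberCoord hra 1 = fun _ => 1 := by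
  rw [chamberCoord, map_one]
  rfl

theorem chamberCoord_simple_mul (hra : M.IsRightAngled) (s : B) (w : W) :
    cs.chamberCoord hra (cs.simple s * w) =
      cs.dualReflection s (cs.chamberCoord hra w) := by
  rw [chamberCoord, map_mul, lift_apply_simple]
  rfl

/-- For a minimal word, a coordinate is negative only if the corresponding letter can be moved
to the front, and the coordinates of two non-commuting generators have positive sum. -/
theorem IsMinimalWord.chamberCoord_spec (hra : M.IsRightAngled) {l : List B}
    (hl : cs.IsMinimalWord l) :
    (∀ s t, cs.IsBlocker s t →
      0 < cs.chamberCoord hra (cs.wordProd l) s + cs.chamberCoord hra (cs.wordProd l) t) ∧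
    ∀ s, 0 < cs.chamberCoord hra (cs.wordProd l) s ∨
      ∃ l₁ l₂, l = l₁ ++ s :: l₂ ∧ s ∉ l₁ ∧ ∀ t ∈ l₁, ¬ cs.IsBlocker s t := by
  induction l with
  | nil => simp [chamberCoord_one]
  | cons a l ih =>
    obtain ⟨hsum, hpos⟩ := ih hl.of_cons
    rw [wordProd_cons, chamberCoord_simple_mul]
    set f := cs.chamberCoord hra (cs.wordProd l)
    have ha : 0 < f a := by
      refine (hpos a).resolve_right ?_
      rintro ⟨l₁, l₂, rfl, hal, hb⟩
      obtain ⟨t, ht, hbt⟩ := hl a [] l₁ l₂ (by simp) hal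
      exact hb t ht hbt
    have hle (t : B) (ht : t ≠ a) : f t ≤ cs.dualReflection a f t := by
      by_cases hb : cs.IsBlocker a t
      · rw [dualReflection_of_isBlocker hb]; omega
      · rw [dualReflection_of_not_isBlocker ht hb]
    refine ⟨fun s t hst => ?_, fun s => ?_⟩
    · have h := hsum s t hst
      by_cases hs : s = a
      · subst hs
        rw [dualReflection_self, dualReflection_of_isBlocker hst]
        omega
      by_cases ht : t = a
      · subst ht
        rw [dualReflection_self, dualReflection_of_isBlocker hst.symm]
        omega
      linarith [hle s hs, hle t ht]
    · by_cases hs : s = a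
      · exact .inr ⟨[], l, by simp [hs], by simp, by simp⟩
      by_cases hb : cs.IsBlocker a s
      · left
        have := hsum a s hb
        rw [dualReflection_of_isBlocker hb]
        omega
      rcases hpos s with h | ⟨l₁, l₂, rfl, hsl, hb'⟩
      · exact .inl (h.trans_le (hle s hs))
      · refine .inr ⟨a :: l₁, l₂, by simp, by simp [hs, hsl], ?_⟩
        rintro t ht
        rcases List.mem_cons.1 ht with rfl | ht
        · exact fun h => hb h.symm
        · exact hb' t ht

theorem IsMinimalWord.chamberCoord_cons_neg (hra : M.IsRightAngled) {s : B} {l : List B}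
    (hl : cs.IsMinimalWord (s :: l)) :
    cs.chamberCoord hra (cs.wordProd (s :: l)) s < 0 := by
  rw [wordProd_cons, chamberCoord_simple_mul, dualReflection_self, neg_lt_zero]
  refine ((hl.of_cons.chamberCoord_spec hra).2 s).resolve_right ?_
  rintro ⟨l₁, l₂, rfl, hsl, hb⟩
  obtain ⟨t, ht, hbt⟩ := hl s [] l₁ l₂ (by simp) hsl
  exact hb t ht hbt

theorem IsMinimalWord.perm_of_reducedWord (hra : M.IsRightAngled) {l m : List B}
    (hl : cs.IsMinimalWord l) (hm : cs.ReducedWord m) (h : cs.wordProd l = cs.wordProd m) :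
    l.Perm m := by
  induction l generalizing m with
  | nil =>
    have := hm [] h
    rw [List.eq_nil_of_length_eq_zero (Nat.le_zero.1 this)]
  | cons s l ih =>
    have hneg := hl.chamberCoord_cons_neg hra
    rw [h] at hneg
    obtain ⟨m₁, m₂, rfl, -, hb⟩ :=
      ((hm.isMinimalWord.chamberCoord_spec hra).2 s).resolve_left hneg.not_gt
    have hprod : cs.wordProd (m₁ ++ s :: m₂) = cs.simple s * cs.wordProd (m₁ ++ m₂) := by
      simp only [wordProd_append, wordProd_cons, ← mul_assoc, (commute_wordProd hb).eq]
    have hred : cs.ReducedWord (m₁ ++ m₂) := by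
      intro m' hm'
      have := hm (s :: m') (by rw [wordProd_cons, hm', hprod])
      simp at this ⊢
      omega
    rw [wordProd_cons, hprod] at h
    exact ((ih hl.of_cons hred (mul_left_cancel h)).cons s).trans List.perm_middle.symm

theorem exists_reducedWord (w : W) : ∃ m, cs.ReducedWord m ∧ cs.wordProd m = w := by
  obtain ⟨m, hm, hmw⟩ := cs.exists_isReduced w
  refine ⟨m, fun l' hl' => ?_, hmw.symm⟩
  rw [← hm.eq, ← hl']
  exact cs.length_wordProd_le l'

open Classical in
/-- A minimal word has the fewest occurrences of each letter among all words representing the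
same element. -/
theorem IsMinimalWord.count_le (hra : M.IsRightAngled) {l l' : List B}
    (hl : cs.IsMinimalWord l) (h : cs.wordProd l = cs.wordProd l') (s : B) :
    l.count s ≤ l'.count s := by
  induction hn : l'.length using Nat.strong_induction_on generalizing l' with
  | _ n ih =>
    by_cases hl' : cs.IsMinimalWord l'
    · obtain ⟨m, hm, hml⟩ := cs.exists_reducedWord (cs.wordProd l)
      have h₁ := hl.perm_of_reducedWord hra hm hml.symm
      have h₂ := hl'.perm_of_reducedWord hra hm (h.symm.trans hml.symm)
      exact ((h₁.trans h₂.symm).count_eq s).le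
    · simp only [IsMinimalWord, SMinimal] at hl'
      push Not at hl'
      obtain ⟨t, l₁, l₂, l₃, rfl, -, hb⟩ := hl'
      rw [wordProd_cancel hb] at h
      refine (ih _ ?_ h rfl).trans ?_
      · simp at hn ⊢; omega
      · simp only [List.count_append, List.count_cons]; omega

theorem exists_word_of_mem_closure {J : Set B} {w : W}
    (hw : w ∈ Subgroup.closure (cs.simple '' J)) :
    ∃ x, cs.wordProd x = w ∧ ∀ t ∈ x, t ∈ J := by
  induction hw using Subgroup.closure_induction with
  | mem w hw =>
    obtain ⟨t, ht, rfl⟩ := hw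
    exact ⟨[t], by simp, by simpa⟩
  | one => exact ⟨[], by simp, by simp⟩
  | mul v w _ _ hv hw =>
    obtain ⟨x, rfl, hx⟩ := hv
    obtain ⟨y, rfl, hy⟩ := hw
    refine ⟨x ++ y, by simp [wordProd_append], fun t ht => ?_⟩
    exact (List.mem_append.1 ht).elim (hx t) (hy t)
  | inv w _ hw =>
    obtain ⟨x, rfl, hx⟩ := hw
    exact ⟨x.reverse, by simp, by simpa⟩

/-- An infinite irreducible Coxeter system has a blocker for every generator. -/
theorem IsIrreducible.exists_isBlocker [Infinite W] (hirr : cs.IsIrreducible) (s : B) :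
    ∃ t, cs.IsBlocker s t := by
  by_contra! h
  refine hirr ⟨{s}, Set.singleton_nonempty s, ?_, ?_⟩
  · by_contra hne
    have hall (t : B) : t = s := by
      by_contra ht
      exact hne ⟨t, ht⟩
    refine Set.infinite_univ (α := W) (Set.Finite.subset (Set.toFinite {1, cs.simple s}) ?_)
    rintro w -
    induction w using cs.simple_induction_left with
    | one => simp
    | mul_simple_left w i hw =>
      rw [hall i]
      rcases hw with rfl | rfl <;> simp
  · rintro i rfl j -
    exact not_not.1 (h j)

theorem SMinimal.append {s : B} {x y : List B} (hx : cs.SMinimal x s) (hy : cs.SMinimal y s)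
    (hxy : ∀ x₁ x₂ y₁ y₂, x = x₁ ++ s :: x₂ → y = y₁ ++ s :: y₂ → s ∉ x₂ → s ∉ y₁ →
      ∃ t ∈ x₂ ++ y₁, cs.IsBlocker s t) :
    cs.SMinimal (x ++ y) s := by
  intro l₁ l₂ l₃ h hs
  rw [List.append_assoc, List.append_eq_append_iff] at h
  rcases h with ⟨z, rfl, rfl⟩ | ⟨z, rfl, hz⟩
  · exact hy z l₂ l₃ (by simp) hs
  rcases z with _ | ⟨a, z⟩
  · exact hy [] l₂ l₃ (by simpa using hz.symm) hs
  simp only [List.cons_append, List.cons.injEq] at hz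
  obtain ⟨rfl, hz⟩ := hz
  rw [List.append_eq_append_iff] at hz
  rcases hz with ⟨c, rfl, hc⟩ | ⟨c, rfl, rfl⟩
  · rcases c with _ | ⟨b, c⟩
    · have := hxy l₁ l₂ [] l₃ (by simp) (by simpa using hc.symm) hs (by simp)
      simpa using this
    · simp only [List.cons_append, List.cons.injEq] at hc
      obtain ⟨rfl, rfl⟩ := hc
      exact hx l₁ l₂ c (by simp) hs
  · rw [List.mem_append, not_or] at hs
    exact hxy l₁ z c l₃ rfl rfl hs.1 hs.2

theorem SGood.sMinimal_flatten_replicate {s t : B} {l : List B} (hgood : cs.SGood l s)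
    (hs : s ∈ l) (ht : t ∈ l) (hst : cs.IsBlocker s t) (n : ℕ) :
    cs.SMinimal (List.replicate n l).flatten s := by
  induction n with
  | zero => intro l₁ l₂ l₃ h; simp at h
  | succ n ih =>
    rw [List.replicate_succ, List.flatten_cons]
    refine hgood.1.append ih fun x₁ x₂ y₁ y₂ hx hy hsx hsy => ?_
    obtain ⟨y, hy⟩ : ∃ y, l = y₁ ++ s :: y := by
      cases n with
      | zero => simp at hy
      | succ n =>
        rw [List.replicate_succ, List.flatten_cons, List.append_eq_append_iff] at hy
        rcases hy with ⟨z, rfl, -⟩ | ⟨z, rfl, hz⟩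
        · simp [hs] at hsy
        · rcases z with _ | ⟨b, z⟩
          · simp at hs; exact absurd hs hsy
          · simp only [List.cons_append, List.cons.injEq] at hz
            exact ⟨z, by rw [hz.1]⟩
    have hts : t ≠ s := by rintro rfl; exact not_isBlocker_self _ hst
    have h := hx.symm.trans hy
    rw [List.append_eq_append_iff] at h
    rcases h with ⟨z, hz, hz'⟩ | ⟨z, hz, hz'⟩
    · rcases z with _ | ⟨b, z⟩
      · simp only [List.append_nil, List.nil_append, List.cons.injEq, true_and] at hz hz'
        subst hz
        rw [hx] at ht
        refine ⟨t, ?_, hst⟩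
        simp only [List.mem_append, List.mem_cons, hts, false_or] at ht ⊢
        exact ht.symm
      · simp only [List.cons_append, List.cons.injEq] at hz'
        simp [hz, hz'.1] at hsy
    · rcases z with _ | ⟨b, z⟩
      · simp only [List.append_nil, List.nil_append, List.cons.injEq, true_and] at hz hz'
        subst hz
        rw [hx] at ht
        refine ⟨t, ?_, hst⟩
        simp only [List.mem_append, List.mem_cons, hts, false_or] at ht ⊢
        exact ht.symm
      · simp only [List.cons_append, List.cons.injEq] at hz'
        obtain ⟨rfl, -⟩ := hz'
        exact hgood.2 y₁ z x₂ (by rw [hx, hz]) hsy hsx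

theorem wordProd_flatten_replicate (l : List B) (n : ℕ) :
    cs.wordProd (List.replicate n l).flatten = cs.wordProd l ^ n := by
  induction n with
  | zero => simp
  | succ n ih => rw [List.replicate_succ, List.flatten_cons, wordProd_append, ih, pow_succ']

end CoxeterSystem

/-- In an infinite, irreducible, non-affine right-angled Coxeter system, if a reduced
word contains every generator and is `s`-good for every `s ∈ S`, then the element it
represents is essential. -/
theorem stmt_9 {B W : Type*} [Fintype B] [Group W] {M : CoxeterMatrix B}
    (cs : CoxeterSystem M W) (hra : M.IsRightAngled) [Infinite W]
    (hirr : cs.IsIrreducible) (hnaff : ¬ IsVirtuallyFreeAbelian W)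
    (l : List B) (hl : cs.ReducedWord l) (hall : ∀ s : B, s ∈ l)
    (hgood : ∀ s : B, cs.SGood l s) :
    cs.IsEssential (cs.wordProd l) := by
  classical
  intro u J hJ
  by_contra hne
  obtain ⟨s, hs⟩ := (Set.ne_univ_iff_exists_notMem J).1 hne
  obtain ⟨v, hv⟩ := cs.wordProd_surjective u
  let n := 2 * v.count s + 1
  obtain ⟨x, hx, hxJ⟩ := CoxeterSystem.exists_word_of_mem_closure (pow_mem hJ n)
  have hmin : cs.IsMinimalWord (List.replicate n l).flatten := fun a =>
    let ⟨t, ht⟩ := hirr.exists_isBlocker a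
    (hgood a).sMinimal_flatten_replicate (hall a) (hall t) ht n
  have hpow : (u⁻¹ * cs.wordProd l * u) ^ n = u⁻¹ * cs.wordProd l ^ n * u := by
    simpa using conj_pow (i := n) (a := u⁻¹) (b := cs.wordProd l)
  have hprod : cs.wordProd (List.replicate n l).flatten =
      cs.wordProd (v ++ x ++ v.reverse) := by
    rw [CoxeterSystem.wordProd_flatten_replicate, cs.wordProd_append, cs.wordProd_append,
      cs.wordProd_reverse, hx, hv, hpow]
    group
  have hcount := hmin.count_le hra hprod s
  have hxs : x.count s = 0 := List.count_eq_zero.2 fun h => hs (hxJ s h)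
  have hls : 0 < l.count s := List.count_pos_iff.2 (hall s)
  simp only [List.count_flatten, List.map_replicate, List.sum_replicate, smul_eq_mul,
    List.count_append, List.count_reverse, hxs] at hcount
  have := Nat.le_mul_of_pos_right n hls
  omega
end
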